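/- Let γ ≥ 2 be a countable ordinal and Σ a finite alphabet containing a letter 0. If there exists a Σ⁰_γ-complete ω-language L ⊆ Σ^ω accepted by a real-time Büchi 1-counter automaton, then there exists an infinitary rational relation R ⊆ Γ^ω × Γ^ω (where Γ = Σ ∪ {A}) which, regarded as an ω-language over the product alphabet Γ × Γ, is Σ⁰_γ-complete. -/

import Mathlib

universe u

/-- We equip `Option σ` (the alphabet `Γ = Σ ∪ {A}`, with `A = none`) with the
discrete topology. -/
instance instTopOption (σ : Type u) : TopologicalSpace (Option σ) := ⊥
instance instDiscreteOption (σ : Type u) : DiscreteTopology (Option σ) := ⟨rfl⟩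

/-- Auxiliary function for the coding map `h`: reads position `i` inside the
concatenation of the blocks `A·0^(n+1)·x(n), A·0^(n+2)·x(n+1), ...`. -/
def hAux {σ : Type u} (z : σ) (x : ℕ → σ) : ℕ → ℕ → Option σ
  | _, 0 => none
  | n, (i+1) =>
    if i + 1 ≤ n + 1 then some z
    else if i + 1 = n + 2 then some (x n)
    else hAux z x (n+1) (i + 1 - (n+3))
  termination_by n i => i
  decreasing_by omega

/-- The coding map `h : Σ^ω → Γ^ω`,
`h(x) = A·0·x(1)·A·0²·x(2)·A·0³·x(3)···A·0ⁿ·x(n)···` (ω-words indexed by `ℕ`). -/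
def hmap {σ : Type u} (z : σ) (x : ℕ → σ) : ℕ → Option σ := fun i => hAux z x 0 i

/-- Auxiliary function for the ω-word `α₀`. -/
def aAux {σ : Type u} (z : σ) : ℕ → ℕ → Option σ
  | _, 0 => none
  | n, (i+1) =>
    if i + 1 ≤ n + 1 then some z
    else aAux z (n+1) (i + 1 - (n+2))
  termination_by n i => i
  decreasing_by omega

/-- The ω-word `α₀ = A·0·A·0²·A·0³···A·0ⁿ···` over `Γ = Σ ∪ {A}`. -/
def alphaWord {σ : Type u} (z : σ) : ℕ → Option σ := fun i => aAux z 0 i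

/-- The Borel hierarchy on a topological space `X`: `SigmaPi X α true` is the class
`Σ⁰_α` and `SigmaPi X α false` is the class `Π⁰_α`.  `Σ⁰_1` is the class of open
sets, `Π⁰_1` is the class of closed sets, and for `α ≥ 2`, `Σ⁰_α` (resp. `Π⁰_α`)
is the class of countable unions (resp. intersections) of sets in
`⋃_{γ < α} Π⁰_γ` (resp. `⋃_{γ < α} Σ⁰_γ`). -/
def SigmaPi (X : Type u) [TopologicalSpace X] (α : Ordinal.{0}) (b : Bool) : Set (Set X) :=
  {s | (α = 1 ∧ ((b = true ∧ IsOpen s) ∨ (b = false ∧ IsClosed s)))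
    ∨ (α ≠ 1 ∧ ∃ f : ℕ → Set X,
        (∀ n : ℕ, ∃ γ : Ordinal.{0}, ∃ _ : γ < α, f n ∈ SigmaPi X γ !b) ∧
        s = if b then ⋃ n, f n else ⋂ n, f n)}
  termination_by α
  decreasing_by assumption

/-- The class `Σ⁰_α` of the Borel hierarchy on `X`. -/
abbrev Sigma0 (X : Type u) [TopologicalSpace X] (α : Ordinal.{0}) : Set (Set X) :=
  SigmaPi X α true

/-- The class `Π⁰_α` of the Borel hierarchy on `X`. -/
abbrev Pi0 (X : Type u) [TopologicalSpace X] (α : Ordinal.{0}) : Set (Set X) :=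
  SigmaPi X α false

/-- `F ⊆ Σ^ω` is `Σ⁰_α`-complete (for `b = true`), resp. `Π⁰_α`-complete (for
`b = false`), iff for every nonempty finite alphabet `Y` and every `E ⊆ Y^ω`
(with `Y^ω` carrying the Cantor topology, i.e. the product of the discrete
topology): `E ∈ Σ⁰_α` (resp. `Π⁰_α`) iff `E = f⁻¹(F)` for some continuous
`f : Y^ω → Σ^ω`. -/
def IsCompleteFor (b : Bool) (α : Ordinal.{0}) {σ : Type} [TopologicalSpace σ]
    (F : Set (ℕ → σ)) : Prop :=
  ∀ (Y : Type), Fintype Y → Nonempty Y → ∀ E : Set (ℕ → Y),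
    letI : TopologicalSpace Y := ⊥
    (E ∈ SigmaPi (ℕ → Y) α b ↔
      ∃ f : (ℕ → Y) → (ℕ → σ), Continuous f ∧ E = f ⁻¹' F)

/-- The infinite concatenation of the finite words `u 0, u 1, u 2, ...` equals the
ω-word `x`: every finite partial concatenation is a prefix of `x`, and the total
length is infinite. -/
def JoinsTo {α : Type u} (u : ℕ → List α) (x : ℕ → α) : Prop :=
  (∀ N : ℕ, ∃ n : ℕ, N ≤ (((List.range n).map u).flatten).length) ∧
  (∀ (n i : ℕ) (h : i < (((List.range n).map u).flatten).length),
      (((List.range n).map u).flatten)[i]'h = x i)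

/-- A 2-tape Büchi automaton with input alphabet `σ` and output alphabet `γ`:
a finite set of states `Q`, a finite set `trans ⊆ Q × σ^⋆ × γ^⋆ × Q` of
transitions, an initial state `init` and a set `acc` of accepting states. -/
structure TwoTapeBuchi (σ γ : Type u) where
  Q : Type u
  finQ : Finite Q
  trans : Set (Q × List σ × List γ × Q)
  finTrans : trans.Finite
  init : Q
  acc : Set Q

/-- The pair `(x, y)` of ω-words is accepted by the 2-tape Büchi automaton `T`
iff it is the pair of input and output words of some successful computation. -/
def TwoTapeBuchi.Accepts {σ γ : Type u} (T : TwoTapeBuchi σ γ)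
    (x : ℕ → σ) (y : ℕ → γ) : Prop :=
  ∃ (q : ℕ → T.Q) (u : ℕ → List σ) (v : ℕ → List γ),
    q 0 = T.init ∧
    (∀ n : ℕ, (q n, u n, v n, q (n+1)) ∈ T.trans) ∧
    (∃ qf ∈ T.acc, ∀ n : ℕ, ∃ m : ℕ, n ≤ m ∧ q m = qf) ∧
    JoinsTo u x ∧ JoinsTo v y

/-- `R ⊆ Σ^ω × Γ^ω` is an infinitary rational relation iff it is the relation
accepted by some 2-tape Büchi automaton. -/
def IsRatRel {σ γ : Type u} (R : Set ((ℕ → σ) × (ℕ → γ))) : Prop :=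
  ∃ T : TwoTapeBuchi σ γ, ∀ p : (ℕ → σ) × (ℕ → γ), p ∈ R ↔ T.Accepts p.1 p.2

/-- A real-time Büchi 1-counter automaton: transitions are in
`Q × σ × Bool × Q × ℤ` with the counter move in `{-1, 0, 1}`, and a zero test
(`false` means the counter is zero) which forbids decrementing a zero counter. -/
structure OneCounterBuchi (σ : Type u) where
  Q : Type u
  finQ : Finite Q
  trans : Set (Q × σ × Bool × Q × ℤ)
  transMoves : ∀ t ∈ trans, t.2.2.2.2 = -1 ∨ t.2.2.2.2 = 0 ∨ t.2.2.2.2 = 1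
  transZero : ∀ t ∈ trans, t.2.2.1 = false → t.2.2.2.2 = 0 ∨ t.2.2.2.2 = 1
  init : Q
  acc : Set Q

/-- One computation step of a 1-counter automaton on letter `a`, from
configuration `p` to configuration `p'`. -/
def OneCounterBuchi.Step {σ : Type u} (M : OneCounterBuchi σ) (a : σ)
    (p p' : M.Q × ℕ) : Prop :=
  ∃ j : ℤ, (p.1, a, (p.2 ≠ 0 : Bool), p'.1, j) ∈ M.trans ∧ (p'.2 : ℤ) = (p.2 : ℤ) + j

/-- The ω-word `x` is accepted by the real-time Büchi 1-counter automaton `M`: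
there is a run on `x` starting in `(q₀, 0)` in which some accepting state occurs
infinitely often. -/
def OneCounterBuchi.Accepts {σ : Type u} (M : OneCounterBuchi σ) (x : ℕ → σ) : Prop :=
  ∃ r : ℕ → M.Q × ℕ,
    r 0 = (M.init, 0) ∧
    (∀ i : ℕ, M.Step (x i) (r i) (r (i+1))) ∧
    ∃ qf ∈ M.acc, ∀ n : ℕ, ∃ m : ℕ, n ≤ m ∧ (r m).1 = qf

/-- The identification of a pair of ω-words with an ω-word over the product
alphabet. -/
def pairToWord {a b : Type u} (p : (ℕ → a) × (ℕ → b)) : ℕ → a × b :=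
  fun n => (p.1 n, p.2 n)

/-! ### One-letter automata -/

/-- The factor of length `m` of `y` starting at position `j`. -/
def seg {α : Type u} (y : ℕ → α) (j m : ℕ) : List α := (List.range m).map (fun k => y (j + k))

@[simp] theorem seg_length {α : Type u} (y : ℕ → α) (j m : ℕ) : (seg y j m).length = m := by
  simp [seg]

theorem seg_add {α : Type u} (y : ℕ → α) (j a b : ℕ) :
    seg y j (a + b) = seg y j a ++ seg y (j + a) b := by
  simp [seg, List.range_add, Function.comp_def, add_assoc]

theorem seg_one {α : Type u} (y : ℕ → α) (j : ℕ) : seg y j 1 = [y j] := by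
  simp [seg]

theorem seg_two {α : Type u} (y : ℕ → α) (j : ℕ) : seg y j 2 = [y j, y (j+1)] := by
  simp [seg, List.range_succ]

/-- Partial concatenations. -/
def flt {α : Type u} (u : ℕ → List α) (n : ℕ) : List α := ((List.range n).map u).flatten

theorem flt_succ {α : Type u} (u : ℕ → List α) (n : ℕ) : flt u (n+1) = flt u n ++ u n := by
  simp [flt, List.range_succ]

theorem joinsTo_iff {α : Type u} (u : ℕ → List α) (x : ℕ → α) :
    JoinsTo u x ↔ ∃ p : ℕ → ℕ, p 0 = 0 ∧ (∀ n, p (n+1) = p n + (u n).length) ∧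
      (∀ n, u n = seg x (p n) (u n).length) ∧ ∀ N, ∃ n, N ≤ p n := by
  have key : JoinsTo u x ↔ (∀ N, ∃ n, N ≤ (flt u n).length) ∧
      ∀ n, flt u n = seg x 0 (flt u n).length := by
    unfold JoinsTo
    refine and_congr Iff.rfl (forall_congr' fun n => ?_)
    constructor
    · intro h
      apply List.ext_getElem
      · simp
      · intro i h1 h2
        rw [show (flt u n)[i] = x i from h i h1]
        simp [seg]
    · intro h i hi
      change (flt u n)[i]'hi = x i
      have : (flt u n)[i]? = (seg x 0 (flt u n).length)[i]? := by rw [← h]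
      have hi' : i < (flt u n).length := hi
      rw [List.getElem?_eq_getElem hi', List.getElem?_eq_getElem (by simpa using hi')] at this
      simp [seg] at this
      exact this
  rw [key]
  constructor
  · rintro ⟨h1, h2⟩
    refine ⟨fun n => (flt u n).length, by simp [flt], fun n => by simp [flt_succ], fun n => ?_, h1⟩
    have := h2 (n+1)
    rw [flt_succ, List.length_append, seg_add, ← h2 n] at this
    simpa using List.append_cancel_left this
  · rintro ⟨p, p0, p1, p2, p3⟩
    have hp : ∀ n, (flt u n).length = p n := by
      intro n
      induction n with
      | zero => simp [flt, p0]
      | succ n ih => rw [flt_succ, List.length_append, ih, p1]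
    refine ⟨fun N => by simpa [hp] using p3 N, fun n => ?_⟩
    induction n with
    | zero => simp [flt, seg]
    | succ n ih =>
      rw [flt_succ, List.length_append, seg_add, ← ih, Nat.zero_add, hp, ← p2 n]

/-- Automata reading exactly one letter on the first tape at each step. -/
structure OneLetter (Γ : Type u) where
  Q : Type u
  fin : Finite Q
  I : Set Q
  F : Set Q
  step : Q → Γ → List Γ → Q → Prop
  bound : ∀ q a v q', step q a v q' → v.length ≤ 2

/-- Acceptance condition for one-letter automata. -/
def OneLetter.Acc {Γ : Type u} (A : OneLetter Γ) (x y : ℕ → Γ) : Prop :=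
  ∃ (q : ℕ → A.Q) (j : ℕ → ℕ), q 0 ∈ A.I ∧ j 0 = 0 ∧
    (∀ n, ∃ m, A.step (q n) (x n) (seg y (j n) m) (q (n+1)) ∧ j (n+1) = j n + m) ∧
    (∀ N, ∃ n, N ≤ j n) ∧ (∀ n, ∃ m, n ≤ m ∧ q m ∈ A.F)

theorem quad_inj {A B C D : Type*} {a a' : A} {b b' : B} {c c' : C} {d d' : D}
    (h : (a, b, c, d) = (a', b', c', d')) : a = a' ∧ b = b' ∧ c = c' ∧ d = d' := by
  simpa using h

/-- Conversion to a 2-tape Büchi automaton. -/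
def OneLetter.toT {Γ : Type u} [Finite Γ] (A : OneLetter Γ) : TwoTapeBuchi Γ Γ where
  Q := Option A.Q
  finQ := by have := A.fin; infer_instance
  trans := {p | (∃ q ∈ A.I, p = (none, [], [], some q)) ∨
    ∃ q a v q', A.step q a v q' ∧ p = (some q, [a], v, some q')}
  finTrans := by
    have := A.fin
    have hf : {l : List Γ | l.length ≤ 2}.Finite := List.finite_length_le Γ 2
    refine Set.Finite.subset
      ((Set.finite_univ (α := Option A.Q)).prod (hf.prod (hf.prod
        (Set.finite_univ (α := Option A.Q))))) ?_
    rintro p (⟨q, -, rfl⟩ | ⟨q, a, v, q', h, rfl⟩)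
    · simp
    · simpa using A.bound _ _ _ _ h
  init := none
  acc := some '' A.F

theorem OneLetter.accepts_iff {Γ : Type u} [Finite Γ] (A : OneLetter Γ) (x y : ℕ → Γ) :
    A.toT.Accepts x y ↔ A.Acc x y := by
  constructor
  · rintro ⟨q, u, v, h0, ht, ⟨qf, hqf, hinf⟩, hu, hv⟩
    rw [joinsTo_iff] at hu hv
    obtain ⟨p, p0, p1, p2, -⟩ := hu
    obtain ⟨j, j0, j1, j2, j3⟩ := hv
    have hsome : ∀ n, ∃ s, q (n+1) = some s := by
      intro n
      rcases ht n with ⟨s, -, h⟩ | ⟨_, _, _, s, -, h⟩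
      · exact ⟨s, (Prod.ext_iff.1 (Prod.ext_iff.1 (Prod.ext_iff.1 h).2).2).2⟩
      · exact ⟨s, (Prod.ext_iff.1 (Prod.ext_iff.1 (Prod.ext_iff.1 h).2).2).2⟩
    choose s hs using hsome
    have h00 : s 0 ∈ A.I ∧ u 0 = [] ∧ v 0 = [] := by
      rcases ht 0 with ⟨s', hs', h⟩ | ⟨_, _, _, s', -, h⟩
      · replace h := quad_inj h
        rw [hs 0] at h
        have : s 0 = s' := Option.some.inj h.2.2.2
        exact ⟨this ▸ hs', h.2.1, h.2.2.1⟩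
      · replace h := quad_inj h
        rw [h0] at h
        exact absurd h.1 (by simp [OneLetter.toT])
    have hst : ∀ n, ∃ a, u (n+1) = [a] ∧ A.step (s n) a (v (n+1)) (s (n+1)) := by
      intro n
      rcases ht (n+1) with ⟨s', hs', h⟩ | ⟨s1, a, v', s', hstep, h⟩
      · replace h := quad_inj h
        rw [hs n] at h
        exact absurd h.1 (by simp)
      · replace h := quad_inj h
        rw [hs n, hs (n+1)] at h
        obtain ⟨e1, e2, e3, e4⟩ := h
        have e1 := Option.some.inj e1
        have e4 := Option.some.inj e4
        subst e1 e4
        exact ⟨a, e2, e3 ▸ hstep⟩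
    have hp : ∀ n, p (n+1) = n := by
      intro n
      induction n with
      | zero => simp [p1, p0, h00.2.1]
      | succ n ih =>
        obtain ⟨a, ha, -⟩ := hst n
        rw [p1, ih, ha]; rfl
    refine ⟨s, fun n => j (n+1), h00.1, by simp [j1, j0, h00.2.2], fun n => ?_, ?_, ?_⟩
    · obtain ⟨a, ha, hstep⟩ := hst n
      refine ⟨(v (n+1)).length, ?_, j1 _⟩
      rw [← j2]
      have := p2 (n+1)
      rw [ha, hp] at this
      simp [seg] at this
      exact this ▸ hstep
    · intro N
      obtain ⟨n, hn⟩ := j3 N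
      exact ⟨n, by change N ≤ j (n+1); have := j1 n; omega⟩
    · intro n
      obtain ⟨m, hm, e⟩ := hinf (n+1)
      obtain ⟨f, hf, rfl⟩ := hqf
      obtain ⟨m, rfl⟩ : ∃ k, m = k + 1 := ⟨m - 1, by omega⟩
      refine ⟨m, by omega, ?_⟩
      rw [hs m] at e
      exact (Option.some.inj e) ▸ hf
  · rintro ⟨q, j, h0, j0, hst, hj, hF⟩
    choose m hm1 hm2 using hst
    refine ⟨fun n => Nat.casesOn n none (fun k => some (q k)),
      fun n => Nat.casesOn n [] (fun k => [x k]),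
      fun n => Nat.casesOn n [] (fun k => seg y (j k) (m k)), rfl, ?_, ?_, ?_, ?_⟩
    · intro n
      cases n with
      | zero => exact Or.inl ⟨q 0, h0, rfl⟩
      | succ n => exact Or.inr ⟨_, _, _, _, hm1 n, rfl⟩
    · have := A.fin
      have hfr : ∃ᶠ n in Filter.atTop, ∃ f : A.F, q n = f := by
        rw [Filter.frequently_atTop]
        intro n
        obtain ⟨k, hk, hq⟩ := hF n
        exact ⟨k, hk, ⟨_, hq⟩, rfl⟩
      by_contra hcon
      push Not at hcon
      have : ∀ f : A.F, ∀ᶠ n in Filter.atTop, q n ≠ f := by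
        intro f
        obtain ⟨n, hn⟩ := hcon (some f.1) ⟨f.1, f.2, rfl⟩
        rw [Filter.eventually_atTop]
        refine ⟨n, fun k hk e => hn (k+1) (by omega) ?_⟩
        exact congrArg some e
      apply hfr
      filter_upwards [Filter.eventually_all.2 this] with n hn
      rintro ⟨f, hf⟩
      exact hn f hf
    · rw [joinsTo_iff]
      refine ⟨fun n => n - 1, rfl, ?_, ?_, fun N => ⟨N+1, by simp⟩⟩
      · rintro (_|n) <;> simp
      · rintro (_|n) <;> simp [seg]
    · rw [joinsTo_iff]
      refine ⟨fun n => j (n - 1), j0, ?_, ?_, fun N => ?_⟩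
      · rintro (_|n) <;> simp [hm2]
      · rintro (_|n) <;> simp [seg]
      · obtain ⟨n, hn⟩ := hj N
        exact ⟨n+1, by simpa using hn⟩

/-! ### The pattern -/

/-- Positions of the letter `A`. -/
def Pat (k : ℕ) : Prop := ∃ n, k = 2 ^ (n+1)

/-- Number of pattern positions strictly before `t`. -/
def cnt (t : ℕ) : ℕ := Nat.log 2 (t - 1)

theorem pat_odd (k : ℕ) : ¬ Pat (2*k+1) := by
  rintro ⟨n, hn⟩
  rw [pow_succ] at hn; omega

theorem pat_even (k : ℕ) : Pat (2*k) ↔ (k = 1 ∨ (2 ≤ k ∧ Pat k)) := by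
  constructor
  · rintro ⟨n, hn⟩
    rw [pow_succ] at hn
    have hk : k = 2^n := by omega
    cases n with
    | zero => left; simpa using hk
    | succ n =>
      right
      refine ⟨?_, n, hk⟩
      rw [hk, pow_succ]
      have := Nat.one_le_two_pow (n := n); omega
  · rintro (rfl | ⟨-, n, rfl⟩)
    · exact ⟨0, rfl⟩
    · exact ⟨n+1, by rw [pow_succ 2 (n+1)]; ring⟩

theorem pat_unique (a : ℕ → Prop) (h1 : ∀ k, a (2*k) ↔ (k = 1 ∨ (2 ≤ k ∧ a k)))
    (h2 : ∀ k, ¬ a (2*k+1)) (k : ℕ) : a k ↔ Pat k := by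
  induction k using Nat.strong_induction_on with
  | _ k ih =>
    rcases Nat.even_or_odd' k with ⟨c, rfl | rfl⟩
    · rw [h1, pat_even]
      by_cases hc : 2 ≤ c
      · rw [ih c (by omega)]
      · simp [hc]
    · simp [h2, pat_odd]

theorem pat_iff_cnt (t : ℕ) : Pat t ↔ t = 2 ^ (cnt t + 1) := by
  constructor
  · rintro ⟨n, rfl⟩
    have : cnt (2^(n+1)) = n := by
      unfold cnt
      rw [Nat.log_eq_iff (by
        by_cases h : n = 0
        · right; subst h; simp
        · left; exact h)] 
      rw [pow_succ]
      have := Nat.one_le_two_pow (n := n); omega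
    rw [this]
  · exact fun h => ⟨_, h⟩

theorem cnt_pow (n : ℕ) : cnt (2^(n+1)) = n := by
  have := (pat_iff_cnt (2^(n+1))).1 ⟨n, rfl⟩
  have := Nat.pow_right_injective le_rfl this
  omega

theorem le_pow_cnt (t : ℕ) : t ≤ 2 ^ (cnt t + 1) := by
  have := Nat.lt_pow_succ_log_self (b := 2) one_lt_two (t - 1)
  unfold cnt
  have h : (Nat.log 2 (t-1)).succ = Nat.log 2 (t-1) + 1 := rfl
  omega

theorem cnt_succ_of_pat {t : ℕ} (h : Pat t) : cnt (t+1) = cnt t + 1 := by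
  obtain ⟨n, rfl⟩ := h
  rw [cnt_pow]
  unfold cnt
  simp

theorem cnt_succ_of_not_pat {t : ℕ} (h : ¬ Pat t) : cnt (t+1) = cnt t := by
  rw [pat_iff_cnt] at h
  have h1 := le_pow_cnt t
  have h2 : t < 2 ^ (cnt t + 1) := lt_of_le_of_ne h1 h
  by_cases h0 : t ≤ 1
  · interval_cases t <;> simp [cnt]
  · apply le_antisymm
    · unfold cnt at *
      simp only [Nat.add_sub_cancel]
      exact Nat.le_of_lt_succ (Nat.log_lt_of_lt_pow (by omega) h2)
    · unfold cnt; exact Nat.log_mono_right (by omega)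

theorem cnt_lt {t : ℕ} (h : 2 ≤ t) : cnt t < t - 1 := Nat.log_lt_self 2 (by omega)

theorem cnt_le (t : ℕ) : cnt t ≤ t - 1 := Nat.log_le_self 2 _

theorem const_between {β : Type*} (f : ℕ → β) (hf : ∀ t, ¬ Pat t → f (t+1) = f t) (t : ℕ) :
    f t = f (2 ^ (cnt t + 1)) := by
  have key : ∀ d t, t + d = 2 ^ (cnt t + 1) → f t = f (2 ^ (cnt t + 1)) := by
    intro d
    induction d with
    | zero => intro t h; rw [← h]; rfl
    | succ d ih =>
      intro t h
      have hp : ¬ Pat t := by rw [pat_iff_cnt]; omega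
      have := cnt_succ_of_not_pat hp
      rw [← hf t hp, ih (t+1) (by rw [this]; omega), this]
  exact key (2 ^ (cnt t + 1) - t) t (by have := le_pow_cnt t; omega)

theorem pat_sub_iff {n c : ℕ} (hc : c ≤ n) : Pat (2^(n+1) - c) ↔ c = 0 := by
  constructor
  · rintro ⟨k, hk⟩
    have h1 : n < 2^n := Nat.lt_two_pow_self
    have h2 : 2^n < 2^(k+1) := by rw [← hk, pow_succ]; omega
    have h3 : n < k + 1 := (Nat.pow_lt_pow_iff_right (by norm_num)).1 h2
    have h4 : 2^(n+1) ≤ 2^(k+1) := Nat.pow_le_pow_right (by norm_num) (by omega)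
    have h5 : n < 2^(n+1) := by rw [pow_succ]; omega
    omega
  · rintro rfl; exact ⟨n, rfl⟩

/-! ### The automaton -/

/-- States. -/
inductive St (Q σ : Type) : Type
  | eq : St Q σ
  | dbl (n : Fin 3) : St Q σ
  | sink : St Q σ
  | sim (q : Q) (s : σ) (m : Fin 3) : St Q σ

instance St.finite {Q σ : Type} [Finite Q] [Finite σ] : Finite (St Q σ) := by
  let g : Unit ⊕ Fin 3 ⊕ Unit ⊕ (Q × σ × Fin 3) → St Q σ
    | .inl _ => .eq
    | .inr (.inl n) => .dbl n
    | .inr (.inr (.inl _)) => .sink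
    | .inr (.inr (.inr (q, s, m))) => .sim q s m
  apply Finite.of_surjective g
  rintro (_ | n | _ | ⟨q, s, m⟩)
  · exact ⟨.inl (), rfl⟩
  · exact ⟨.inr (.inl n), rfl⟩
  · exact ⟨.inr (.inr (.inl ())), rfl⟩
  · exact ⟨.inr (.inr (.inr (q, s, m))), rfl⟩

/-- Truncated counter. -/
def tr (k : ℕ) : Fin 3 := ⟨min k 2, by omega⟩

/-- Violation of the doubling rule. -/
def Bad {σ : Type} (n : Fin 3) (a b c : Option σ) : Prop :=
  c = none ∨ ¬ (b = none ↔ (n.val = 1 ∨ (n.val = 2 ∧ a = none)))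

/-- Steps. -/
inductive Stp {σ : Type} (M : OneCounterBuchi σ) :
    St M.Q σ → Option σ → List (Option σ) → St M.Q σ → Prop
  | eqGo (a b) : Stp M .eq a [b] .eq
  | eqBad (a b) (h : ¬ (a = none ↔ b = none)) : Stp M .eq a [b] .sink
  | dblGo (n : Fin 3) (a b c) : Stp M (.dbl n) a [b, c] (.dbl (tr (n.val+1)))
  | dblBad (n : Fin 3) (a b c) (h : Bad n a b c) : Stp M (.dbl n) a [b, c] .sink
  | sinkGo (a v) (h : v.length ≤ 2) : Stp M .sink a v .sink
  | simGo (q s) (m : Fin 3) (a v) (h : v.length = m.val) :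
      Stp M (.sim q s m) (some a) v (.sim q a 1)
  | simTest (q s d b q' δ) (m : Fin 3) (hb : b = true ↔ d ≠ none)
      (h : (q, s, b, q', δ) ∈ M.trans) (hm : (m.val : ℤ) = 1 - δ) :
      Stp M (.sim q s 1) none [d] (.sim q' s m)

/-- The automaton. -/
def autom {σ : Type} [Finite σ] (z : σ) (M : OneCounterBuchi σ) : OneLetter (Option σ) where
  Q := St M.Q σ
  fin := by have := M.finQ; infer_instance
  I := {.eq, .dbl 0, .sim M.init z 1}
  F := {q | q = .sink ∨ ∃ p ∈ M.acc, ∃ s m, q = .sim p s m}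
  step := Stp M
  bound := by
    intro q a v q' h
    cases h with
    | sinkGo _ _ h => exact h
    | simGo _ _ m _ _ h => rw [h]; omega
    | _ => simp

/-- The set of correct codes. -/
def Good {σ : Type} (x y : ℕ → Option σ) : Prop :=
  ∀ k, (x k = none ↔ Pat k) ∧ (y k = none ↔ Pat k)

/-- Decoding. -/
def dec {σ : Type} (z : σ) (x : ℕ → Option σ) : ℕ → σ := fun n => (x (2^(n+1) - 1)).getD z

theorem acc_of_not_good {σ : Type} [Finite σ] (z : σ) (M : OneCounterBuchi σ)
    (x y : ℕ → Option σ) (h : ¬ Good x y) : (autom z M).Acc x y := by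
  by_cases h1 : ∃ k, ¬ (x k = none ↔ y k = none)
  · obtain ⟨k, hk⟩ := h1
    refine ⟨fun t => if t ≤ k then St.eq else St.sink, fun t => t, ?_, rfl, ?_, fun N => ⟨N, le_rfl⟩,
      ?_⟩
    · exact Or.inl (by simp)
    · intro n
      refine ⟨1, ?_, rfl⟩
      rw [seg_one]
      change Stp M _ _ _ _
      by_cases a1 : n + 1 ≤ k
      · simp only [a1, show n ≤ k by omega, if_true]; exact Stp.eqGo _ _
      · by_cases a2 : n ≤ k
        · simp only [a1, a2, if_true, if_false]
          obtain rfl : n = k := by omega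
          exact Stp.eqBad _ _ hk
        · simp only [a1, a2, if_false]
          exact Stp.sinkGo _ _ (by simp)
    · intro n
      refine ⟨n + k + 1, by omega, ?_⟩
      exact Or.inl (by simp [show ¬ (n + k + 1 ≤ k) by omega])
  · push Not at h1
    have h2 : ∃ k, Bad (tr k) (x k) (y (2*k)) (y (2*k+1)) := by
      by_contra hcon
      push Not at hcon
      apply h
      have hx : ∀ k, x k = none ↔ Pat k := by
        apply pat_unique
        · intro k
          have := hcon k
          simp only [Bad, not_or, not_not] at this
          rw [h1, this.2]
          simp only [tr]
          rcases Nat.lt_or_ge k 2 with hk | hk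
          · interval_cases k <;> simp
          · simp [hk, show k ≠ 1 by omega]
        · intro k
          have := hcon k
          simp only [Bad, not_or] at this
          rw [h1]; exact this.1
      exact fun k => ⟨hx k, by rw [← h1, hx]⟩
    obtain ⟨k, hk⟩ := h2
    refine ⟨fun t => if t ≤ k then St.dbl (tr t) else St.sink, fun t => 2*t, ?_, rfl, ?_,
      fun N => ⟨N, by change N ≤ 2 * N; omega⟩, ?_⟩
    · exact Or.inr (Or.inl (by simp [tr]))
    · intro n
      refine ⟨2, ?_, by ring⟩
      rw [seg_two]
      change Stp M _ _ _ _
      by_cases a1 : n + 1 ≤ k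
      · simp only [a1, show n ≤ k by omega, if_true]
        have : tr (n+1) = tr ((tr n).val+1) := by ext; simp only [tr]; omega
        rw [this]
        exact Stp.dblGo _ _ _ _
      · by_cases a2 : n ≤ k
        · simp only [a1, a2, if_true, if_false]
          obtain rfl : n = k := by omega
          exact Stp.dblBad _ _ _ _ hk
        · simp only [a1, a2, if_false]
          exact Stp.sinkGo _ _ (by simp)
    · intro n
      refine ⟨n + k + 1, by omega, ?_⟩
      exact Or.inl (by simp [show ¬ (n + k + 1 ≤ k) by omega])

theorem not_pat_pred {n : ℕ} : ¬ Pat (2^(n+1) - 1) := by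
  have := Nat.one_le_two_pow (n := n)
  have h : 2^(n+1) - 1 = 2 * (2^n - 1) + 1 := by rw [pow_succ]; omega
  rw [h]; exact pat_odd _

theorem acc_of_accepts {σ : Type} [Finite σ] (z : σ) (M : OneCounterBuchi σ)
    (x y : ℕ → Option σ) (hg : Good x y) (h : M.Accepts (dec z x)) : (autom z M).Acc x y := by
  obtain ⟨r, r0, hr, qf, hqf, hinf⟩ := h
  have hmv : ∀ n, (r (n+1)).2 ≤ (r n).2 + 1 ∧ (r n).2 ≤ (r (n+1)).2 + 1 := by
    intro n
    obtain ⟨δ, h1, h2⟩ := hr n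
    have := M.transMoves _ h1
    simp only at this
    omega
  have hc : ∀ n, (r n).2 ≤ n := by
    intro n
    induction n with
    | zero => simp [r0]
    | succ n ih => have := (hmv n).1; omega
  have hmv' : ∀ t, (r (cnt (t+1))).2 ≤ (r (cnt t)).2 + 1 ∧ (r (cnt t)).2 ≤ (r (cnt (t+1))).2 + 1 := by
    intro t
    by_cases hp : Pat t
    · rw [cnt_succ_of_pat hp]; exact hmv _
    · rw [cnt_succ_of_not_pat hp]; omega
  have hm' : ∀ t, (r (cnt t)).2 ≤ (r (cnt (t-1))).2 + 1 ∧ (r (cnt (t-1))).2 ≤ (r (cnt t)).2 + 1 := by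
    rintro (_ | t)
    · simp
    · exact hmv' t
  let sf : ℕ → σ := fun t => Nat.rec z (fun k p => (x k).getD p) t
  have sfs : ∀ t, sf (t+1) = (x t).getD (sf t) := fun t => rfl
  let mf : ℕ → Fin 3 := fun t => ⟨1 + (r (cnt (t-1))).2 - (r (cnt t)).2, by have := hm' t; omega⟩
  let jf : ℕ → ℕ := fun t => t - (r (cnt (t-1))).2
  have hj : ∀ t, jf t + (r (cnt (t-1))).2 = t := by
    intro t
    have h1 := hc (cnt (t-1))
    have h2 := cnt_le (t-1)
    simp only [jf]; omega
  have hm : ∀ t, (mf t).val + (r (cnt t)).2 = 1 + (r (cnt (t-1))).2 := by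
    intro t
    have := hm' t
    simp only [mf]; omega
  refine ⟨fun t => St.sim (r (cnt t)).1 (sf t) (mf t), jf, ?_, ?_, ?_, ?_, ?_⟩
  · have : mf 0 = 1 := by ext; simp [mf]
    exact Or.inr (Or.inr (by simp [this, cnt, r0, sf]))
  · simp [jf]
  · intro t
    refine ⟨(mf t).val, ?_, ?_⟩
    · change Stp M (St.sim (r (cnt t)).1 (sf t) (mf t)) _ _
        (St.sim (r (cnt (t+1))).1 (sf (t+1)) (mf (t+1)))
      by_cases hp : Pat t
      · have hx : x t = none := (hg t).1.2 hp
        have ht := (pat_iff_cnt t).1 hp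
        have hnp : ¬ Pat (t-1) := by rw [ht]; exact not_pat_pred
        have ht1 : 2 ≤ t := by
          rw [ht, pow_succ]; have := Nat.one_le_two_pow (n := cnt t); omega
        have hcc : cnt t = cnt (t-1) := by
          have := cnt_succ_of_not_pat hnp
          rwa [show t - 1 + 1 = t by omega] at this
        have hm1 : mf t = 1 := by
          ext; have := hm t; rw [hcc] at this; simp only [Fin.val_one]; omega
        have hss : sf (t+1) = sf t := by rw [sfs, hx]; rfl
        have hst : sf t = dec z x (cnt t) := by
          unfold dec
          rw [← ht]
          have h1 := sfs (t-1)
          rw [show t - 1 + 1 = t by omega] at h1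
          rw [h1]
          have h2 : x (t-1) ≠ none := fun e => hnp ((hg _).1.1 e)
          obtain ⟨a, ha⟩ := Option.ne_none_iff_exists'.1 h2
          rw [ha]; rfl
        obtain ⟨δ, h1, h2⟩ := hr (cnt t)
        have hmt := hm (t+1)
        have hmt0 := hm' (t+1)
        simp only [Nat.add_sub_cancel] at hmt hmt0
        rw [hss, hx, hm1, cnt_succ_of_pat hp]
        rw [← hst] at h1
        rw [cnt_succ_of_pat hp] at hmt hmt0
        have : seg y (jf t) ((1 : Fin 3)).val = [y (jf t)] := seg_one _ _
        rw [this]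
        refine Stp.simTest _ _ _ _ _ δ _ ?_ h1 ?_
        · have hjt := hj t
          rw [← hcc] at hjt
          have hjt2 : jf t = 2^(cnt t + 1) - (r (cnt t)).2 := by omega
          rw [ne_eq (y (jf t)), (hg _).2, hjt2, pat_sub_iff (hc _)]
          simp
        · omega
      · have h2 : x t ≠ none := fun e => hp ((hg _).1.1 e)
        obtain ⟨a, ha⟩ := Option.ne_none_iff_exists'.1 h2
        have hmt := hm (t+1)
        simp only [Nat.add_sub_cancel] at hmt
        rw [cnt_succ_of_not_pat hp] at hmt
        have hm1 : mf (t+1) = 1 := by ext; simp only [Fin.val_one]; omega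
        rw [hm1, sfs, ha, cnt_succ_of_not_pat hp]
        exact Stp.simGo _ _ _ _ _ (by simp)
    · have h1 := hj t
      have h2 := hj (t+1)
      have h3 := hm t
      simp only [Nat.add_sub_cancel] at h2
      omega
  · intro N
    refine ⟨2^(N+2), ?_⟩
    have h1 := hj (2^(N+2))
    have h2 := hc (cnt (2^(N+2) - 1))
    have h3 : cnt (2^(N+2) - 1) ≤ cnt (2^(N+1+1)) := by
      unfold cnt; exact Nat.log_mono_right (by simp only [add_assoc]; norm_num)
    rw [cnt_pow] at h3
    have h4 : N < 2^N := Nat.lt_two_pow_self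
    have h5 : 2^(N+2) = 4 * 2^N := by rw [pow_add]; ring
    omega
  · intro n
    obtain ⟨k, hk, e⟩ := hinf n
    refine ⟨2^(k+1), ?_, ?_⟩
    · have h4 : k+1 < 2^(k+1) := Nat.lt_two_pow_self
      omega
    · right
      refine ⟨qf, hqf, sf (2^(k+1)), mf (2^(k+1)), ?_⟩
      simp only [cnt_pow, e]

theorem accepts_of_acc {σ : Type} [Finite σ] (z : σ) (M : OneCounterBuchi σ)
    (x y : ℕ → Option σ) (hg : Good x y) (h : (autom z M).Acc x y) : M.Accepts (dec z x) := by
  obtain ⟨q, j, h0, j0, hst, -, hF⟩ := h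
  have hst' : ∀ n, ∃ m, Stp M (q n) (x n) (seg y (j n) m) (q (n+1)) ∧ j (n+1) = j n + m := hst
  clear hst
  rcases h0 with h0 | h0 | h0
  · exfalso
    have inv : ∀ t, q t = St.eq ∧ j t = t := by
      intro t
      induction t with
      | zero => exact ⟨h0, j0⟩
      | succ t ih =>
        obtain ⟨m, hs, hj⟩ := hst' t
        rw [ih.1, ih.2] at hs
        generalize hv : seg y t m = v at hs
        generalize hq : q (t+1) = q' at hs ⊢
        have hl : m = v.length := by rw [← hv]; simp
        cases hs with
        | eqGo _ b => exact ⟨rfl, by rw [hj, hl, ih.2]; rfl⟩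
        | eqBad _ b hb =>
          exfalso
          simp at hl
          subst hl
          rw [seg_one] at hv
          simp at hv
          subst hv
          exact hb ((hg t).1.trans (hg t).2.symm)
    obtain ⟨m, -, hm⟩ := hF 0
    rw [(inv m).1] at hm
    rcases hm with hm | ⟨_, _, _, _, hm⟩ <;> cases hm
  · exfalso
    have inv : ∀ t, q t = St.dbl (tr t) ∧ j t = 2 * t := by
      intro t
      induction t with
      | zero => exact ⟨h0, j0⟩
      | succ t ih =>
        obtain ⟨m, hs, hj⟩ := hst' t
        rw [ih.1, ih.2] at hs
        generalize hv : seg y (2*t) m = v at hs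
        generalize hq : q (t+1) = q' at hs ⊢
        have hl : m = v.length := by rw [← hv]; simp
        cases hs with
        | dblGo _ _ b c =>
          refine ⟨?_, by rw [hj, hl, ih.2]; simp; ring⟩
          congr 1
          ext; simp only [tr]; omega
        | dblBad _ _ b c hb =>
          exfalso
          simp at hl
          subst hl
          rw [seg_two] at hv
          simp at hv
          obtain ⟨rfl, rfl⟩ := hv
          rcases hb with hb | hb
          · exact pat_odd _ ((hg _).2.1 hb)
          · apply hb
            rw [(hg _).1, (hg _).2, pat_even]
            simp only [tr]
            rcases Nat.lt_or_ge t 2 with hk | hk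
            · interval_cases t <;> simp
            · simp [hk, show t ≠ 1 by omega]
    obtain ⟨m, -, hm⟩ := hF 0
    rw [(inv m).1] at hm
    rcases hm with hm | ⟨_, _, _, _, hm⟩ <;> cases hm
  · have hsim : ∀ t, ∃ p s m, q t = St.sim p s m := by
      intro t
      induction t with
      | zero => exact ⟨_, _, _, h0⟩
      | succ t ih =>
        obtain ⟨p, s, m, e⟩ := ih
        obtain ⟨k, hs, -⟩ := hst' t
        rw [e] at hs
        generalize q (t+1) = q' at hs ⊢
        generalize x t = xt at hs
        generalize seg y (j t) k = v at hs
        cases hs <;> exact ⟨_, _, _, rfl⟩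
    choose P S m hq using hsim
    have hsome : ∀ t, ¬ Pat t → P (t+1) = P t ∧ x t = some (S (t+1)) ∧ (m (t+1)).val = 1 ∧
        j (t+1) = j t + (m t).val := by
      intro t hp
      have h2 : x t ≠ none := fun e => hp ((hg _).1.1 e)
      obtain ⟨a, ha⟩ := Option.ne_none_iff_exists'.1 h2
      obtain ⟨k, hs, hj⟩ := hst' t
      rw [hq, hq, ha] at hs
      generalize hv : seg y (j t) k = v at hs
      have hl : k = v.length := by rw [← hv]; simp
      generalize hP : P (t+1) = P' at hs ⊢
      generalize hS : S (t+1) = S' at hs ⊢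
      generalize hm : m (t+1) = m' at hs ⊢
      generalize hm0 : m t = m0 at hs ⊢
      generalize hS0 : S t = S0 at hs
      generalize hP0 : P t = P0 at hs ⊢
      cases hs with
      | simGo _ _ _ _ _ h => exact ⟨rfl, ha, rfl, by rw [hj, hl, h]⟩
    have hnone : ∀ t, Pat t → (m t).val = 1 ∧ j (t+1) = j t + 1 ∧ ∃ b δ,
        (b = true ↔ ¬ Pat (j t)) ∧ (P t, S t, b, P (t+1), δ) ∈ M.trans ∧
        ((m (t+1)).val : ℤ) = 1 - δ := by
      intro t hp
      have ha : x t = none := (hg _).1.2 hp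
      obtain ⟨k, hs, hj⟩ := hst' t
      rw [hq, hq, ha] at hs
      generalize hv : seg y (j t) k = v at hs
      have hl : k = v.length := by rw [← hv]; simp
      generalize hP : P (t+1) = P' at hs ⊢
      generalize hS : S (t+1) = S' at hs ⊢
      generalize hm : m (t+1) = m' at hs ⊢
      generalize hm0 : m t = m0 at hs ⊢
      generalize hS0 : S t = S0 at hs ⊢
      generalize hP0 : P t = P0 at hs ⊢
      cases hs with
      | simTest _ _ d b _ δ _ hb h hm' =>
        simp at hl
        subst hl
        rw [seg_one] at hv
        simp at hv
        subst hv
        refine ⟨rfl, hj, b, δ, ?_, h, hm'⟩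
        rw [hb, ← (hg _).2]
    let c : ℕ → ℤ := fun t => t + 1 - j t - (m t).val
    have c0 : c 0 = 0 := by
      have : m 0 = 1 := by
        have := hq 0
        rw [h0] at this
        injection this with _ _ h3
        exact h3.symm
      simp [c, j0, this]
    have P0 : P 0 = M.init := by
      have := hq 0
      rw [h0] at this
      injection this with h1 _ _
      exact h1.symm
    have cns : ∀ t, ¬ Pat t → c (t+1) = c t := by
      intro t hp
      obtain ⟨-, -, e1, e2⟩ := hsome t hp
      simp only [c, e1, e2]; push_cast; ring
    have hcon := const_between (fun t => (P t, c t)) (fun t hp => by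
      simp only [cns t hp, (hsome t hp).1])
    simp only [Prod.mk.injEq] at hcon
    -- one step at pattern positions
    have hstep : ∀ n : ℕ, 0 ≤ c (2^(n+1)) → c (2^(n+1)) ≤ n → ∃ b δ,
        (b = true ↔ c (2^(n+1)) ≠ 0) ∧
        (P (2^(n+1)), dec z x n, b, P (2^(n+1+1)), δ) ∈ M.trans ∧
        c (2^(n+1+1)) = c (2^(n+1)) + δ := by
      intro n hn0 hn1
      obtain ⟨e1, e2, b, δ, hb, htr, e3⟩ := hnone (2^(n+1)) ⟨n, rfl⟩
      have hcs := hcon (2^(n+1)+1)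
      rw [cnt_succ_of_pat ⟨n, rfl⟩, cnt_pow] at hcs
      have hce : c (2^(n+1)) = (2^(n+1) : ℕ) - (j (2^(n+1)) : ℤ) := by
        simp only [c, e1]; push_cast; ring
      obtain ⟨k, hk⟩ := Int.eq_ofNat_of_zero_le hn0
      have hjk : j (2^(n+1)) = 2^(n+1) - k := by omega
      refine ⟨b, δ, ?_, ?_, ?_⟩
      · rw [hb, hjk, pat_sub_iff (by omega), hk]; simp
      · rw [← hcs.1]
        have : dec z x n = S (2^(n+1)) := by
          have h1 := (hsome _ (not_pat_pred (n := n))).2.1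
          rw [show 2^(n+1) - 1 + 1 = 2^(n+1) by
            have := Nat.one_le_two_pow (n := n+1); omega] at h1
          simp [dec, h1]
        rw [this]; exact htr
      · rw [← hcs.2, hce]
        simp only [c, e2, e3]; push_cast; ring
    have hc : ∀ n : ℕ, 0 ≤ c (2^(n+1)) ∧ c (2^(n+1)) ≤ n := by
      intro n
      induction n with
      | zero =>
        have := (hcon 0).2
        rw [c0] at this
        rw [show cnt 0 = 0 by simp [cnt]] at this
        rw [← this]; simp
      | succ n ih =>
        obtain ⟨b, δ, hb, htr, e⟩ := hstep n ih.1 ih.2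
        have h1 := M.transMoves _ htr
        have h2 := M.transZero _ htr
        simp only at h1 h2
        have h3 : c (2^(n+1)) = 0 → b = false := by
          intro h; rw [← Bool.not_eq_true, hb]; simpa using h
        rw [e]
        push_cast
        rcases eq_or_ne (c (2^(n+1))) 0 with h4 | h4
        · have := h2 (h3 h4); omega
        · omega
    refine ⟨fun n => (P (2^(n+1)), (c (2^(n+1))).toNat), ?_, ?_, ?_⟩
    · have := hcon 0
      rw [c0, P0] at this
      rw [show cnt 0 = 0 by simp [cnt]] at this
      simp only [← this.1, ← this.2, Int.toNat_zero]
    · intro n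
      obtain ⟨b, δ, hb, htr, e⟩ := hstep n (hc n).1 (hc n).2
      refine ⟨δ, ?_, ?_⟩
      · have : (decide ((c (2^(n+1))).toNat ≠ 0)) = b := by
          rw [Bool.eq_iff_iff, hb, decide_eq_true_eq]
          have := (hc n).1
          omega
        simp only [this]
        exact htr
      · have h1 := (hc n).1
        have h2 := (hc (n+1)).1
        simp only [Int.toNat_of_nonneg h1, Int.toNat_of_nonneg h2]
        exact e
    · have hacc : ∀ n, ∃ k, n ≤ k ∧ P (2^(k+1)) ∈ M.acc := by
        intro n
        obtain ⟨t, ht, hm⟩ := hF (2^n+1)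
        refine ⟨cnt t, ?_, ?_⟩
        · unfold cnt
          exact Nat.le_log_of_pow_le one_lt_two (by omega)
        · rw [← (hcon t).1]
          rw [hq t] at hm
          rcases hm with hm | ⟨p, hp, s, m', hm⟩
          · cases hm
          · injection hm with h1
            rw [h1]; exact hp
      have := M.finQ
      by_contra hcon
      push Not at hcon
      have : ∀ f : M.acc, ∀ᶠ n in Filter.atTop, P (2^(n+1)) ≠ f := by
        intro f
        obtain ⟨n, hn⟩ := hcon f.1 f.2
        rw [Filter.eventually_atTop]
        exact ⟨n, fun k hk e => hn k hk e⟩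
      have := Filter.eventually_all.2 this
      rw [Filter.eventually_atTop] at this
      obtain ⟨n, hn⟩ := this
      obtain ⟨k, hk, hp⟩ := hacc n
      exact hn k hk ⟨_, hp⟩ rfl

/-! ### Topology -/

theorem sigma_union_open {X : Type} [TopologicalSpace X] {γ : Ordinal.{0}} (hγ : 2 ≤ γ)
    {s : Set X} (hs : s ∈ SigmaPi X γ true) {g : ℕ → Set X} (hg : ∀ n, IsClosed (g n)) :
    s ∪ ⋃ n, g n ∈ SigmaPi X γ true := by
  have h1 : (1 : Ordinal.{0}) < γ := lt_of_lt_of_le (by norm_num) hγ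
  rw [SigmaPi] at hs ⊢
  rcases hs with ⟨e, -⟩ | ⟨-, f, hf, rfl⟩
  · exact absurd e h1.ne'
  · refine Or.inr ⟨h1.ne', fun n => if n % 2 = 0 then f (n/2) else g (n/2), fun n => ?_, ?_⟩
    · by_cases hn : n % 2 = 0
      · simp only [hn, if_true]; exact hf _
      · simp only [hn, if_false]
        refine ⟨1, h1, ?_⟩
        rw [SigmaPi]
        exact Or.inl ⟨rfl, Or.inr ⟨rfl, hg _⟩⟩
    · simp only [if_true]
      ext w
      simp only [Set.mem_union, Set.mem_iUnion]
      constructor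
      · rintro (⟨n, hn⟩ | ⟨n, hn⟩)
        · exact ⟨2*n, by simpa using hn⟩
        · refine ⟨2*n+1, ?_⟩
          rw [if_neg (by omega), show (2*n+1)/2 = n by omega]
          exact hn
      · rintro ⟨n, hn⟩
        split_ifs at hn
        · exact Or.inl ⟨_, hn⟩
        · exact Or.inr ⟨_, hn⟩

open Classical in
/-- Encoding. -/
noncomputable def enc {σ : Type} (x : ℕ → σ) : ℕ → Option σ × Option σ :=
  fun k => if Pat k then (none, none) else (some (x (Nat.log 2 k)), some (x 0))

theorem enc_good {σ : Type} (x : ℕ → σ) :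
    Good (fun n => (enc x n).1) (fun n => (enc x n).2) := by
  intro k
  by_cases h : Pat k <;> simp [enc, h]

theorem dec_enc {σ : Type} (z : σ) (x : ℕ → σ) : dec z (fun n => (enc x n).1) = x := by
  funext n
  have h : Nat.log 2 (2^(n+1) - 1) = n := by
    have := Nat.one_le_two_pow (n := n)
    have h2 : 2^(n+1) = 2^n * 2 := pow_succ _ _
    rw [Nat.log_eq_iff (Or.inr ⟨by norm_num, by omega⟩)]
    omega
  simp [dec, enc, not_pat_pred, h]

/-- For a countable ordinal `γ ≥ 2`: if some `Σ⁰_γ`-complete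
`L ⊆ Σ^ω` is accepted by a real-time Büchi 1-counter automaton, then some
infinitary rational relation `R ⊆ Γ^ω × Γ^ω` (with `Γ = Σ ∪ {A}`), regarded as
an ω-language over the product alphabet `Γ × Γ`, is `Σ⁰_γ`-complete. -/
theorem exists_sigmaComplete_ratRel (σ : Type) [Fintype σ] [Nonempty σ]
    [TopologicalSpace σ] [DiscreteTopology σ] (z : σ)
    (γ : Ordinal.{0}) (hγ : 2 ≤ γ) (hcount : γ.card ≤ Cardinal.aleph0)
    (hex : ∃ (L : Set (ℕ → σ)) (M : OneCounterBuchi σ),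
      L = {x | M.Accepts x} ∧ IsCompleteFor true γ L) :
    ∃ R : Set ((ℕ → Option σ) × (ℕ → Option σ)),
      IsRatRel R ∧ IsCompleteFor true γ
        {w : ℕ → Option σ × Option σ | (fun n => (w n).1, fun n => (w n).2) ∈ R} := by
  classical
  obtain ⟨L, M, hL, hcomp⟩ := hex
  refine ⟨{p | (autom z M).Acc p.1 p.2}, ⟨(autom z M).toT, fun p => ?_⟩, ?_⟩
  · rw [OneLetter.accepts_iff]; rfl
  have hR : ∀ w : ℕ → Option σ × Option σ,
      (autom z M).Acc (fun n => (w n).1) (fun n => (w n).2) ↔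
        (dec z (fun n => (w n).1) ∈ L ∨ ¬ Good (fun n => (w n).1) (fun n => (w n).2)) := by
    intro w
    by_cases hg : Good (fun n => (w n).1) (fun n => (w n).2)
    · simp only [hg, not_true, or_false, hL]
      exact ⟨accepts_of_acc z M _ _ hg, acc_of_accepts z M _ _ hg⟩
    · simp only [hg, not_false_eq_true, or_true, iff_true]
      exact acc_of_not_good z M _ _ hg
  intro Y hY1 hY2 E
  letI : TopologicalSpace Y := ⊥
  have hcY := hcomp Y hY1 hY2
  constructor
  · intro hE
    obtain ⟨f, hf, rfl⟩ := (hcY E).1 hE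
    refine ⟨fun y => enc (f y), ?_, ?_⟩
    · refine continuous_pi fun k => ?_
      by_cases hp : Pat k
      · simp only [enc, hp, if_true]; exact continuous_const
      · simp only [enc, hp, if_false]
        have h1 : Continuous (some : σ → Option σ) := continuous_of_discreteTopology
        exact (h1.comp ((continuous_apply _).comp hf)).prodMk
          (h1.comp ((continuous_apply _).comp hf))
    · ext y
      simp only [Set.mem_preimage, Set.mem_setOf_eq]
      rw [hR, dec_enc]
      simp [enc_good]
  · rintro ⟨f, hf, rfl⟩
    have hc1 : Continuous fun y => dec z (fun n => (f y n).1) := by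
      refine continuous_pi fun k => ?_
      have h1 : Continuous (fun o : Option σ => o.getD z) := continuous_of_discreteTopology
      exact h1.comp (continuous_fst.comp ((continuous_apply _).comp hf))
    have h1 := (hcY ((fun y => dec z (fun n => (f y n).1)) ⁻¹' L)).2 ⟨_, hc1, rfl⟩
    have h2 : ∀ n, IsClosed {y | ¬ (((f y n).1 = none ↔ Pat n) ∧ ((f y n).2 = none ↔ Pat n))} := by
      intro n
      have hd : IsClosed {p : Option σ × Option σ | ¬ ((p.1 = none ↔ Pat n) ∧ (p.2 = none ↔ Pat n))} :=
        isClosed_discrete _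
      exact hd.preimage ((continuous_apply n).comp hf)
    convert sigma_union_open hγ h1 h2 using 1
    ext y
    simp only [Set.mem_preimage, Set.mem_setOf_eq, Set.mem_union, Set.mem_iUnion]
    rw [hR]
    simp only [Good, not_forall]
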